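/- Let d ≥ 1 and n ≥ 1 be natural numbers, let G : ℝ^d → [0,∞] be measurable with G(−x) = G(x) for all x, and let u : ℝ^d → [0,∞) be measurable. Define the convolution powers G_1 := G and G_{k+1}(x) := ∫_{ℝ^d} G_k(x − w) G(w) dw for k ≥ 1. Then ∫ … ∫ (∏_{ν=1}^{n} u(x_ν)) · G(x₁ − y₁) G(y₁ − x₂) G(x₂ − y₂) ⋯ G(x_n − y_n) G(y_n − x₁) dx₁ dy₁ ⋯ dx_n dy_n ≤ (∫_{ℝ^d} u(x)^n dx) · G_{2n}(0), as an inequality in [0,∞]. -/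

import Mathlib

open MeasureTheory ENNReal

/-- Integration over `Fin (m + 1) → E` splits off the coordinate `i`. -/
lemma lintegral_pi_insertNth {E : Type*} [MeasureSpace E] [SigmaFinite (volume : Measure E)]
    {m : ℕ} (i : Fin (m + 1)) {f : (Fin (m + 1) → E) → ℝ≥0∞} (hf : Measurable f) :
    ∫⁻ x, f x = ∫⁻ c : E, ∫⁻ x : Fin m → E, f (i.insertNth (α := fun _ => E) c x) := by
  have h := (volume_preserving_piFinSuccAbove (fun _ : Fin (m + 1) => E) i).symm
  rw [← h.lintegral_comp hf]
  exact lintegral_prod _ (hf.comp (MeasurableEquiv.measurable _)).aemeasurable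

/-- The integral of a product of functions of distinct coordinates is the product of the
integrals. -/
lemma lintegral_fin_pi_prod {E : Type*} [MeasureSpace E] [SigmaFinite (volume : Measure E)]
    {n : ℕ} {f : Fin n → E → ℝ≥0∞} (hf : ∀ i, Measurable (f i)) :
    ∫⁻ y : Fin n → E, ∏ i, f i (y i) = ∏ i, ∫⁻ c, f i c := by
  induction n with
  | zero => simp [lintegral_unique, volume_pi]
  | succ m ih =>
    rw [lintegral_pi_insertNth 0 (by fun_prop), Fin.prod_univ_succ]
    simp only [Fin.insertNth_zero', Fin.prod_univ_succ, Fin.cons_zero, Fin.cons_succ]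
    rw [← ih fun i => hf i.succ, ← lintegral_mul_const _ (hf 0)]
    refine lintegral_congr fun c => ?_
    rw [lintegral_const_mul _ (by fun_prop)]

/-- Integration over `Fin n → E` is invariant under permutations of the coordinates. -/
lemma lintegral_comp_perm {E : Type*} [MeasureSpace E] [SigmaFinite (volume : Measure E)]
    {n : ℕ} (σ : Equiv.Perm (Fin n)) {f : (Fin n → E) → ℝ≥0∞} (hf : Measurable f) :
    ∫⁻ x : Fin n → E, f (fun i => x (σ i)) = ∫⁻ x, f x := by
  have h := volume_measurePreserving_piCongrLeft (fun _ : Fin n => E) σ.symm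
  rw [← h.lintegral_comp hf]
  refine lintegral_congr fun x => congrArg f (funext fun i => ?_)
  simpa using (MeasurableEquiv.piCongrLeft_apply_apply (β := fun _ => E) σ.symm x (σ i)).symm

/-- In a cyclically indexed tuple, shifting the index moves the head to the end. -/
lemma cons_add_one {E : Type*} {m : ℕ} (a : E) (x : Fin m → E) (i : Fin (m + 1)) :
    Fin.cons (α := fun _ => E) a x (i + 1) = Fin.snoc (α := fun _ => E) x a i := by
  induction i using Fin.lastCases with
  | last => simp
  | cast i => simp [Fin.coeSucc_eq_succ]

/-- The arithmetic-geometric mean inequality for a product of `n` nonnegative reals. -/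
lemma prod_ofReal_le_sum_pow {n : ℕ} (hn : n ≠ 0) {a : Fin n → ℝ} (ha : ∀ i, 0 ≤ a i) :
    ∏ i, ENNReal.ofReal (a i) ≤ ∑ i, (n : ℝ≥0∞)⁻¹ * ENNReal.ofReal (a i) ^ n := by
  have hn' : (0 : ℝ) < n := by positivity
  have h := Real.geom_mean_le_arith_mean_weighted Finset.univ (fun _ : Fin n => (n : ℝ)⁻¹)
    (fun i => a i ^ n) (fun _ _ => by positivity) (by simp [hn]) (fun i _ => pow_nonneg (ha i) n)
  simp only [Real.pow_rpow_inv_natCast (ha _) hn] at h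
  rw [← ENNReal.ofReal_prod_of_nonneg fun i _ => ha i]
  refine (ENNReal.ofReal_le_ofReal h).trans_eq ?_
  rw [ENNReal.ofReal_sum_of_nonneg fun i _ => mul_nonneg (by positivity) (pow_nonneg (ha i) n)]
  refine Finset.sum_congr rfl fun i _ => ?_
  rw [ENNReal.ofReal_mul (by positivity), ENNReal.ofReal_inv_of_pos hn', ENNReal.ofReal_natCast,
    ENNReal.ofReal_pow (ha i)]

/-- The convolution of two kernels depends only on the difference of its endpoints. -/
lemma lintegral_kernel_comp {E : Type*} [AddCommGroup E] [MeasureSpace E] [MeasurableAdd E]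
    [(volume : Measure E).IsAddRightInvariant] (f g : E → ℝ≥0∞) (a b : E) :
    ∫⁻ c, f (a - c) * g (c - b) = ∫⁻ w, f (a - b - w) * g w := by
  rw [← lintegral_sub_right_eq_self (fun w => f (a - b - w) * g w) b]
  simp

section ConvolutionPowers

variable {E : Type*} [AddCommGroup E] [MeasureSpace E] [MeasurableAdd₂ E] [MeasurableNeg E]
  [SigmaFinite (volume : Measure E)] {G : E → ℝ≥0∞} {Gk : ℕ → E → ℝ≥0∞}

lemma measurable_convPow (hG : Measurable G) (hGk1 : Gk 1 = G)
    (hGkS : ∀ k, 1 ≤ k → ∀ x, Gk (k + 1) x = ∫⁻ w, Gk k (x - w) * G w) {k : ℕ} (hk : 1 ≤ k) :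
    Measurable (Gk k) := by
  induction k, hk using Nat.le_induction with
  | base => rwa [hGk1]
  | succ k hk ih =>
    rw [funext (hGkS k hk)]
    exact Measurable.lintegral_prod_right' (f := fun p : E × E => Gk k (p.1 - p.2) * G p.2)
      (by fun_prop)

variable [(volume : Measure E).IsAddRightInvariant]

/-- Convolving the `k`-th convolution power with the second one gives the `(k + 2)`-nd. -/
lemma convPow_add_two (hG : Measurable G) (hGk1 : Gk 1 = G)
    (hGkS : ∀ k, 1 ≤ k → ∀ x, Gk (k + 1) x = ∫⁻ w, Gk k (x - w) * G w) {k : ℕ} (hk : 1 ≤ k)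
    (z : E) : ∫⁻ s, Gk k (z - s) * Gk 2 s = Gk (k + 2) z := by
  have hm := measurable_convPow hG hGk1 hGkS hk
  calc ∫⁻ s, Gk k (z - s) * Gk 2 s
      = ∫⁻ s, ∫⁻ w, Gk k (z - s) * (G (s - w) * G w) := by
        refine lintegral_congr fun s => ?_
        rw [hGkS 1 le_rfl, hGk1, lintegral_const_mul _ (by fun_prop)]
    _ = ∫⁻ w, ∫⁻ s, Gk k (z - s) * (G (s - w) * G w) :=
        lintegral_lintegral_swap (by fun_prop)
    _ = ∫⁻ w, (∫⁻ s, Gk k (z - s) * G (s - w)) * G w := by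
        refine lintegral_congr fun w => ?_
        rw [← lintegral_mul_const _ (by fun_prop)]
        simp only [mul_assoc]
    _ = Gk (k + 2) z := by
        rw [hGkS (k + 1) (by omega)]
        refine lintegral_congr fun w => ?_
        rw [lintegral_kernel_comp, hGkS k hk]

/-- Integrating out the `m` interior points of a chain of kernels `Gk 2` from `a` to `b`. -/
lemma lintegral_chain (hG : Measurable G) (hGk1 : Gk 1 = G)
    (hGkS : ∀ k, 1 ≤ k → ∀ x, Gk (k + 1) x = ∫⁻ w, Gk k (x - w) * G w) (m : ℕ) (a b : E) :
    ∫⁻ x : Fin m → E, ∏ i : Fin (m + 1),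
      Gk 2 (Fin.cons (α := fun _ => E) a x i - Fin.snoc (α := fun _ => E) x b i) =
      Gk (2 * (m + 1)) (a - b) := by
  have h2 : Measurable (Gk 2) := measurable_convPow hG hGk1 hGkS one_le_two
  have hmeas (m : ℕ) (b : E) : Measurable fun x : Fin m → E => ∏ i : Fin (m + 1),
      Gk 2 (Fin.cons (α := fun _ => E) a x i - Fin.snoc (α := fun _ => E) x b i) := by
    refine Finset.measurable_fun_prod _ fun i _ => h2.comp (Measurable.sub ?_ ?_)
    · induction i using Fin.cases <;> simp only [Fin.cons_zero, Fin.cons_succ] <;> fun_prop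
    · induction i using Fin.lastCases <;> simp only [Fin.snoc_last, Fin.snoc_castSucc] <;> fun_prop
  induction m generalizing b with
  | zero => simp [lintegral_unique, volume_pi, Fin.snoc]
  | succ m ih =>
    rw [lintegral_pi_insertNth (Fin.last m) (hmeas _ _)]
    simp only [Fin.insertNth_last', Fin.prod_univ_castSucc (n := m + 1), Fin.snoc_castSucc,
      Fin.snoc_last, Fin.cons_snoc_eq_snoc_cons]
    rw [show 2 * (m + 1 + 1) = 2 * (m + 1) + 2 by ring,
      ← convPow_add_two hG hGk1 hGkS (by omega), ← lintegral_kernel_comp]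
    refine lintegral_congr fun c => ?_
    rw [lintegral_mul_const _ (hmeas _ _), ih]

/-- The cyclic integral with a weight at one vertex. -/
lemma lintegral_cycle {n : ℕ} [NeZero n] (hG : Measurable G) (hGk1 : Gk 1 = G)
    (hGkS : ∀ k, 1 ≤ k → ∀ x, Gk (k + 1) x = ∫⁻ w, Gk k (x - w) * G w)
    {v : E → ℝ≥0∞} (hv : Measurable v) (ν : Fin n) :
    ∫⁻ x : Fin n → E, v (x ν) * ∏ i, Gk 2 (x i - x (i + 1)) =
      (∫⁻ z, v z) * Gk (2 * n) 0 := by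
  have h2 : Measurable (Gk 2) := measurable_convPow hG hGk1 hGkS one_le_two
  have hshift := lintegral_comp_perm (E := E) (Equiv.addRight ν)
    (f := fun x => v (x 0) * ∏ i, Gk 2 (x i - x (i + 1))) (by fun_prop)
  have hcycle (x : Fin n → E) : ∏ i, Gk 2 (x (i + ν) - x (i + 1 + ν)) =
      ∏ i, Gk 2 (x i - x (i + 1)) := by
    rw [← Equiv.prod_comp (Equiv.addRight ν) fun i => Gk 2 (x i - x (i + 1))]
    simp only [Equiv.coe_addRight, add_right_comm]
  simp only [Equiv.coe_addRight, zero_add, hcycle] at hshift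
  rw [hshift]
  obtain ⟨m, rfl⟩ := Nat.exists_eq_succ_of_ne_zero (NeZero.ne n)
  rw [lintegral_pi_insertNth 0 (by fun_prop), ← lintegral_mul_const _ hv]
  refine lintegral_congr fun c => ?_
  have hm : Measurable fun x : Fin m → E => ∏ i : Fin (m + 1),
      Gk 2 (Fin.cons (α := fun _ => E) c x i - Fin.cons (α := fun _ => E) c x (i + 1)) := by
    have hc (i : Fin (m + 1)) :
        Measurable fun x : Fin m → E => Fin.cons (α := fun _ => E) c x i := by
      induction i using Fin.cases <;> simp only [Fin.cons_zero, Fin.cons_succ] <;> fun_prop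
    exact Finset.measurable_fun_prod _ fun i _ => h2.comp ((hc _).sub (hc _))
  simp only [Fin.insertNth_zero', Fin.cons_zero]
  rw [lintegral_const_mul _ hm]
  simp only [cons_add_one]
  rw [lintegral_chain hG hGk1 hGkS, sub_self]

end ConvolutionPowers

/-- Iterated Hölder-convolution estimate: for a symmetric nonnegative kernel `G` with
convolution powers `G_k`, and a nonnegative function `u`, the `2n`-fold cyclic integral
`∫⋯∫ (∏_ν u(x_ν)) G(x₁-y₁)G(y₁-x₂)⋯G(x_n-y_n)G(y_n-x₁) ≤ (∫ u^n) · G_{2n}(0)`. -/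
theorem cyclic_kernel_estimate
    (d n : ℕ) [NeZero n] (hd : 1 ≤ d)
    (G : (Fin d → ℝ) → ℝ≥0∞) (hG : Measurable G) (hGsymm : ∀ x, G (-x) = G x)
    (u : (Fin d → ℝ) → ℝ) (hu : ∀ x, 0 ≤ u x) (humeas : Measurable u)
    (Gk : ℕ → (Fin d → ℝ) → ℝ≥0∞)
    (hGk1 : Gk 1 = G)
    (hGkS : ∀ k, 1 ≤ k → ∀ x, Gk (k + 1) x = ∫⁻ w, Gk k (x - w) * G w) :
    (∫⁻ x : Fin n → (Fin d → ℝ), ∫⁻ y : Fin n → (Fin d → ℝ),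
        (∏ ν, ENNReal.ofReal (u (x ν))) * ∏ ν, (G (x ν - y ν) * G (y ν - x (ν + 1))))
      ≤ (∫⁻ z, ENNReal.ofReal (u z) ^ n) * Gk (2 * n) 0 := by
  have hn : n ≠ 0 := NeZero.ne n
  have h2 : Measurable (Gk 2) := measurable_convPow hG hGk1 hGkS one_le_two
  have hinner (x : Fin n → (Fin d → ℝ)) :
      ∫⁻ y : Fin n → (Fin d → ℝ),
        (∏ ν, ENNReal.ofReal (u (x ν))) * ∏ ν, (G (x ν - y ν) * G (y ν - x (ν + 1))) =
      (∏ ν, ENNReal.ofReal (u (x ν))) * ∏ ν, Gk 2 (x ν - x (ν + 1)) := by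
    rw [lintegral_const_mul _ (by fun_prop),
      lintegral_fin_pi_prod (f := fun ν c => G (x ν - c) * G (c - x (ν + 1)))
        fun ν => by fun_prop]
    simp only [lintegral_kernel_comp, hGkS 1 le_rfl, hGk1]
  calc _ = ∫⁻ x : Fin n → (Fin d → ℝ),
        (∏ ν, ENNReal.ofReal (u (x ν))) * ∏ ν, Gk 2 (x ν - x (ν + 1)) :=
        lintegral_congr hinner
    _ ≤ ∫⁻ x : Fin n → (Fin d → ℝ), ∑ ν, (n : ℝ≥0∞)⁻¹ *
        (ENNReal.ofReal (u (x ν)) ^ n * ∏ i, Gk 2 (x i - x (i + 1))) := by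
        refine lintegral_mono fun x => ?_
        simp only [← mul_assoc, ← Finset.sum_mul]
        gcongr
        exact prod_ofReal_le_sum_pow hn fun ν => hu (x ν)
    _ = ∑ _ν : Fin n, (n : ℝ≥0∞)⁻¹ * ((∫⁻ z, ENNReal.ofReal (u z) ^ n) * Gk (2 * n) 0) := by
        rw [lintegral_finsetSum _ fun ν _ => by fun_prop]
        refine Finset.sum_congr rfl fun ν _ => ?_
        rw [lintegral_const_mul _ (by fun_prop),
          lintegral_cycle hG hGk1 hGkS (v := fun z => ENNReal.ofReal (u z) ^ n) (by fun_prop) ν]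
    _ = _ := by
        rw [Finset.sum_const, Finset.card_univ, Fintype.card_fin, nsmul_eq_mul, ← mul_assoc,
          ENNReal.mul_inv_cancel (by simpa using hn) (ENNReal.natCast_ne_top n), one_mul]
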